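/- There exists a constant C > 0 such that for every e ∈ [0,1/2] and every t ∈ ℝ, ‖q_e(t) − (cos t, sin t)‖ ≤ C·e and ‖q̇_e(t) − (−sin t, cos t)‖ ≤ C·e; that is, the Kepler elliptical motion of eccentricity e is uniformly O(e)-close, in position and in velocity, to the uniform circular motion. -/

import Mathlib

/-- First component of the Kepler elliptical motion of eccentricity `e`,
semi-major axis `1` and period `2π`: `q_{e,1}(t) = cos(u(e,t)) − e`. -/
noncomputable def kq1 (U : ℝ → ℝ → ℝ) (e t : ℝ) : ℝ := Real.cos (U e t) - e

/-- Second component: `q_{e,2}(t) = √(1−e²)·sin(u(e,t))`. -/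
noncomputable def kq2 (U : ℝ → ℝ → ℝ) (e t : ℝ) : ℝ :=
  Real.sqrt (1 - e ^ 2) * Real.sin (U e t)

theorem kepler_lip (u v e : ℝ) : |Real.sin u - Real.sin v| ≤ |u - v| ∧ |Real.cos u - Real.cos v| ≤ |u - v| := by
  have h1 := Real.lipschitzWith_sin.dist_le_mul u v
  have h2 := Real.lipschitzWith_cos.dist_le_mul u v
  simp only [Real.dist_eq, NNReal.coe_one, one_mul] at h1 h2
  exact ⟨h1, h2⟩

theorem kepler_sqrt_le (a b x y : ℝ) (ha : |a| ≤ x) (hb : |b| ≤ y) :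
    Real.sqrt (a ^ 2 + b ^ 2) ≤ x + y := by
  have h1 := abs_nonneg a
  have h2 := abs_nonneg b
  apply Real.sqrt_le_iff.2 ⟨by linarith, ?_⟩
  rw [← sq_abs a, ← sq_abs b]
  nlinarith

theorem kepler_deriv (f : ℝ → ℝ) (e : ℝ) (h0 : 0 ≤ e) (h1 : e ≤ 1/2)
    (hf : ∀ l, f l - e * Real.sin (f l) = l) (t : ℝ) :
    HasDerivAt f (1 - e * Real.cos (f t))⁻¹ t := by
  have hL : LipschitzWith 2 f := by
    apply LipschitzWith.of_dist_le_mul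
    intro a b
    simp only [Real.dist_eq, NNReal.coe_ofNat]
    have hs := (kepler_lip (f a) (f b) e).1
    have e1 : f a - f b = (a - b) + e * (Real.sin (f a) - Real.sin (f b)) := by
      linarith [hf a, hf b]
    have e2 : |f a - f b| ≤ |a - b| + |e * (Real.sin (f a) - Real.sin (f b))| := by
      conv_lhs => rw [e1]
      exact abs_add_le _ _
    rw [abs_mul, abs_of_nonneg h0] at e2
    nlinarith [abs_nonneg (f a - f b), abs_nonneg (Real.sin (f a) - Real.sin (f b))]
  have hne : 1 - e * Real.cos (f t) ≠ 0 := by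
    have := Real.cos_le_one (f t)
    nlinarith
  have hg : HasDerivAt (fun u => u - e * Real.sin u) (1 - e * Real.cos (f t)) (f t) :=
    (hasDerivAt_id' (f t)).sub ((Real.hasDerivAt_sin (f t)).const_mul e)
  exact HasDerivAt.of_local_left_inverse hL.continuous.continuousAt hg hne
    (Filter.Eventually.of_forall hf)

/-- There is a constant `C > 0` such that for every
`e ∈ [0,1/2]` and every `t`, `‖q_e(t) − (cos t, sin t)‖ ≤ C·e` and
`‖q̇_e(t) − (−sin t, cos t)‖ ≤ C·e`. -/
theorem stmt_10 (U : ℝ → ℝ → ℝ)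
    (hU : ∀ e ∈ Set.Ico (0:ℝ) 1, ∀ ℓ : ℝ, U e ℓ - e * Real.sin (U e ℓ) = ℓ) :
    ∃ C > 0, ∀ e ∈ Set.Icc (0:ℝ) (1/2), ∀ t : ℝ,
      Real.sqrt ((kq1 U e t - Real.cos t) ^ 2 + (kq2 U e t - Real.sin t) ^ 2)
        ≤ C * e ∧
      Real.sqrt ((deriv (kq1 U e) t - (-Real.sin t)) ^ 2
          + (deriv (kq2 U e) t - Real.cos t) ^ 2) ≤ C * e := by
  refine ⟨7, by norm_num, ?_⟩
  rintro e ⟨h0, h1⟩ t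
  have hf := hU e ⟨h0, by linarith⟩
  have hd := kepler_deriv (U e) e h0 h1 hf t
  have hq1 : HasDerivAt (kq1 U e) (-Real.sin (U e t) * (1 - e * Real.cos (U e t))⁻¹) t :=
    hd.cos.sub_const e
  have hq2 : HasDerivAt (kq2 U e)
      (Real.sqrt (1 - e ^ 2) * (Real.cos (U e t) * (1 - e * Real.cos (U e t))⁻¹)) t :=
    hd.sin.const_mul _
  rw [hq1.deriv, hq2.deriv]
  unfold kq1 kq2
  have hk := hf t
  generalize U e t = u at *
  clear hd hq1 hq2 hf
  obtain ⟨hs, hc⟩ := kepler_lip u t e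
  have hs1 := Real.abs_sin_le_one u
  have hc1 := Real.abs_cos_le_one u
  have hut : |u - t| ≤ e := by
    have : u - t = e * Real.sin u := by linarith
    rw [this, abs_mul, abs_of_nonneg h0]
    nlinarith
  have hw0 : 1 - e ≤ Real.sqrt (1 - e ^ 2) := by
    apply Real.le_sqrt_of_sq_le
    nlinarith
  have hw1 : Real.sqrt (1 - e ^ 2) ≤ 1 := by
    apply Real.sqrt_le_one.2
    nlinarith
  generalize Real.sqrt (1 - e ^ 2) = w at *
  have hr : |(1 - e * Real.cos u)⁻¹ - 1| ≤ 2 * e := by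
    have hp : 1 / 2 ≤ 1 - e * Real.cos u := by
      nlinarith [(abs_le.1 hc1).2]
    have hpos : 0 < 1 - e * Real.cos u := by linarith
    have : (1 - e * Real.cos u)⁻¹ - 1 = e * Real.cos u / (1 - e * Real.cos u) := by
      field_simp
      ring
    rw [this, abs_div, abs_of_pos hpos, div_le_iff₀ hpos, abs_mul, abs_of_nonneg h0]
    nlinarith
  generalize (1 - e * Real.cos u)⁻¹ = r at *
  have hwabs : |w - 1| ≤ e := abs_le.2 ⟨by linarith, by linarith⟩
  have hww : |w| ≤ 1 := abs_le.2 ⟨by linarith, by linarith⟩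
  have key : ∀ a b x : ℝ, |a| ≤ 1 → |b| ≤ x → |a * b| ≤ x := by
    intro a b x ha hb
    rw [abs_mul]
    nlinarith [abs_nonneg a, abs_nonneg b]
  have k1 := key _ _ _ hs1 hwabs
  have k2 := key _ _ _ hs1 hr
  have k3 := key _ _ _ hc1 hwabs
  have k4 := key _ _ _ hww (key _ _ _ hc1 hr)
  rw [abs_le] at k1 k2 k3 k4
  have hs' := abs_le.1 (hs.trans hut)
  have hc' := abs_le.1 (hc.trans hut)
  constructor
  · refine (kepler_sqrt_le _ _ (2 * e) (2 * e) ?_ ?_).trans (by linarith)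
    · rw [abs_le]; constructor <;> linarith
    · rw [abs_le]; constructor <;> linarith
  · refine (kepler_sqrt_le _ _ (3 * e) (4 * e) ?_ ?_).trans (by linarith)
    · rw [abs_le]; constructor <;> linarith
    · rw [abs_le]; constructor <;> linarith
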